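/- The point p = (1/n,...,1/n) ∈ ℝ^{n²} lies in the relative interior of Q_n, and the lattice point m = (1,...,1) is the unique interior lattice point of n·Q_n; moreover n·Q_n − m is a reflexive polytope, so Q_n is a Gorenstein polytope of codegree n. -/

import Mathlib

open Matrix Finset Pointwise

variable (n : ℕ) [NeZero n]

/-- Permutation matrix of `σ`: entries `δ_{i, σ(j)}`. -/
def permMat (σ : Equiv.Perm (ZMod n)) : Matrix (ZMod n) (ZMod n) ℝ :=
  Matrix.of fun i j => if i = σ j then 1 else 0

/-- Rotation `x ↦ x + 1` of the regular n-gon with vertex set `ZMod n`. -/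
def rot : Equiv.Perm (ZMod n) := Equiv.addRight 1

/-- Reflection `x ↦ -x` of the regular n-gon. -/
def rfl' : Equiv.Perm (ZMod n) := Equiv.neg (ZMod n)

/-- The dihedral group `D_n ≤ S_n`, symmetries of the regular n-gon. -/
def dihedral : Subgroup (Equiv.Perm (ZMod n)) := Subgroup.closure {rot n, rfl' n}

/-- Adjacency matrix of the n-cycle `C_n`. -/
def cycAdj : Matrix (ZMod n) (ZMod n) ℝ :=
  Matrix.of fun i j => if j = i + 1 ∨ j = i - 1 then 1 else 0

/-- The permutation polytope `DP_n = conv{M_σ : σ ∈ D_n} ⊆ ℝ^{n×n}`. -/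
def DP : Set (Matrix (ZMod n) (ZMod n) ℝ) :=
  convexHull ℝ {M | ∃ σ ∈ dihedral n, M = permMat n σ}

/-- The cyclic shift matrix `R`. -/
def Rmat : Matrix (ZMod n) (ZMod n) ℝ := Matrix.of fun i j => if j = i + 1 then 1 else 0

/-- The `2n` rows of `W = [[I,...,I],[I,R,...,R^{n-1}]]`, viewed as vectors in
`ℝ^{n²} = Matrix (ZMod n) (ZMod n) ℝ`; the first matrix coordinate is the block index. -/
def Wrow : Bool × ZMod n → Matrix (ZMod n) (ZMod n) ℝ
  | (false, k) => Matrix.of fun _ j => if j = k then 1 else 0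
  | (true, k) => Matrix.of fun b j => (Rmat n ^ b.val) k j

/-- The polytope `Q_n ⊆ ℝ^{n²}`. -/
def Qpoly : Set (Matrix (ZMod n) (ZMod n) ℝ) := convexHull ℝ (Set.range (Wrow n))

/-- A point of `ℝ^{n²}` is a lattice point if all its coordinates are integers. -/
def IsInt (x : Matrix (ZMod n) (ZMod n) ℝ) : Prop := ∀ b j, ∃ z : ℤ, x b j = (z : ℝ)


namespace QGor

/-- The linear map `u ↦ ∑ u_i W_i`. -/
def LL (n : ℕ) [NeZero n] : (Bool × ZMod n → ℝ) →ₗ[ℝ] Matrix (ZMod n) (ZMod n) ℝ where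
  toFun u := Matrix.of fun b j => u (false, j) + u (true, j - b)
  map_add' u v := by ext b j; simp; ring
  map_smul' c u := by ext b j; simp; ring

theorem LL_apply (n : ℕ) [NeZero n] (u : Bool × ZMod n → ℝ) (b j : ZMod n) :
    LL n u b j = u (false, j) + u (true, j - b) := rfl

theorem Rpow (n : ℕ) [NeZero n] (m : ℕ) (i j : ZMod n) :
    (Rmat n ^ m) i j = if j = i + m then 1 else 0 := by
  induction m generalizing j with
  | zero => simp [Matrix.one_apply, eq_comm]
  | succ m ih =>
    rw [pow_succ, Matrix.mul_apply]
    have hR : ∀ k, Rmat n k j = if j = k + 1 then 1 else 0 := fun k => rfl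
    simp only [ih, hR, ite_mul, one_mul, zero_mul]
    rw [Finset.sum_ite_eq' Finset.univ (i + (m : ZMod n))]
    simp [add_assoc]

theorem Wrow_eq (n : ℕ) [NeZero n] (i : Bool × ZMod n) :
    Wrow n i = LL n (fun j => if i = j then 1 else 0) := by
  obtain ⟨c, k⟩ := i
  ext b j
  cases c
  · simp [Wrow, LL_apply, eq_comm]
  · simp only [Wrow, LL_apply, Matrix.of_apply, Rpow]
    simp [eq_sub_iff_add_eq, eq_comm]

/-- The dilate `c Q`, described by coefficients. -/
def S (n : ℕ) [NeZero n] (c : ℝ) : Set (Matrix (ZMod n) (ZMod n) ℝ) :=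
  {x | ∃ u : Bool × ZMod n → ℝ, (∀ i, 0 ≤ u i) ∧ ∑ i, u i = c ∧ LL n u = x}

/-- The affine hull of `c Q`. -/
def A (n : ℕ) [NeZero n] (c : ℝ) : Set (Matrix (ZMod n) (ZMod n) ℝ) :=
  {x | ∃ u : Bool × ZMod n → ℝ, ∑ i, u i = c ∧ LL n u = x}

theorem Q_eq (n : ℕ) [NeZero n] : Qpoly n = S n 1 := by
  have h : Set.range (Wrow n) =
      LL n '' (Set.range fun i j : Bool × ZMod n => if i = j then (1 : ℝ) else 0) := by
    rw [← Set.range_comp]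
    congr 1
    funext i
    exact Wrow_eq n i
  rw [Qpoly, h, ← LinearMap.image_convexHull, convexHull_basis_eq_stdSimplex]
  ext x
  simp only [S, stdSimplex, Set.mem_image, Set.mem_ofPred_eq, and_assoc]

theorem smulQ_eq (n : ℕ) [NeZero n] (c : ℝ) (hc : 0 < c) : c • Qpoly n = S n c := by
  rw [Q_eq]
  ext x
  rw [Set.mem_smul_set]
  constructor
  · rintro ⟨y, ⟨u, h0, h1, rfl⟩, rfl⟩
    refine ⟨c • u, fun i => mul_nonneg hc.le (h0 i), ?_, by simp⟩
    simp [← Finset.mul_sum, h1]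
  · rintro ⟨u, h0, h1, rfl⟩
    refine ⟨LL n (c⁻¹ • u), ⟨c⁻¹ • u, fun i => mul_nonneg (inv_nonneg.2 hc.le) (h0 i), ?_, rfl⟩, ?_⟩
    · simp [← Finset.mul_sum, h1, hc.ne']
    · rw [map_smul, smul_smul, mul_inv_cancel₀ hc.ne', one_smul]

theorem shift (n : ℕ) [NeZero n] (v : Bool × ZMod n → ℝ) (t : ℝ) :
    ∃ u : Bool × ZMod n → ℝ, LL n u = LL n v ∧ ∑ i, u i = ∑ i, v i ∧
      (∀ j, u (false, j) = v (false, j) - t) ∧ ∀ k, u (true, k) = v (true, k) + t := by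
  refine ⟨fun i => v i + (if i.1 then t else -t), ?_, ?_, ?_, ?_⟩
  · ext b j
    simp [LL_apply]
    ring
  · rw [Finset.sum_add_distrib]
    simp [Fintype.sum_prod_type]
  · intro j; simp; ring
  · intro j; simp

theorem S_sub_A (n : ℕ) [NeZero n] (c : ℝ) : S n c ⊆ A n c :=
  fun _ ⟨u, _, h1, h2⟩ => ⟨u, h1, h2⟩

theorem S_nonneg (n : ℕ) [NeZero n] (c : ℝ) {x} (hx : x ∈ S n c) (b j : ZMod n) : 0 ≤ x b j := by
  obtain ⟨u, h0, h1, rfl⟩ := hx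
  exact add_nonneg (h0 _) (h0 _)

/-- Facet membership criterion. -/
theorem mem_facet (n : ℕ) [NeZero n] (c : ℝ) {x} (hx : x ∈ A n c) (b0 j0 : ZMod n)
    (h0 : x b0 j0 = 0) (h : ∀ b j, (j = j0 ∨ j - b = j0 - b0) → 0 ≤ x b j) : x ∈ S n c := by
  obtain ⟨v, h1, rfl⟩ := hx
  obtain ⟨u, hu1, hu2, hu3, hu4⟩ := shift n v (v (false, j0))
  refine ⟨u, ?_, hu2.trans h1, hu1⟩
  rw [LL_apply] at h0
  rintro ⟨c, k⟩
  cases c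
  · have := h (k - (j0 - b0)) k (Or.inr (by ring))
    rw [LL_apply, show k - (k - (j0 - b0)) = j0 - b0 by ring] at this
    rw [hu3]; linarith
  · have := h (j0 - k) j0 (Or.inl rfl)
    rw [LL_apply, show j0 - (j0 - k) = k by ring] at this
    rw [hu4]; linarith

theorem mem_S (n : ℕ) [NeZero n] (c : ℝ) {x} (hx : x ∈ A n c)
    (h : ∀ b j, 0 ≤ x b j) : x ∈ S n c := by
  obtain ⟨v, h1, rfl⟩ := hx
  obtain ⟨j0, hj0⟩ := Finite.exists_min (fun j => v (false, j))
  obtain ⟨u, hu1, hu2, hu3, hu4⟩ := shift n v (v (false, j0))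
  refine ⟨u, ?_, hu2.trans h1, hu1⟩
  rintro ⟨c, k⟩
  cases c
  · rw [hu3]; linarith [hj0 k]
  · have := h (j0 - k) j0
    rw [LL_apply, show j0 - (j0 - k) = k by ring] at this
    rw [hu4]; linarith

theorem A_comb (n : ℕ) [NeZero n] (c : ℝ) {x y z} (hx : x ∈ A n c) (hy : y ∈ A n c)
    (hz : z ∈ A n c) (t : ℝ) : t • (x - y) + z ∈ A n c := by
  obtain ⟨u, hu, rfl⟩ := hx
  obtain ⟨v, hv, rfl⟩ := hy
  obtain ⟨w, hw, rfl⟩ := hz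
  refine ⟨t • (u - v) + w, ?_, by simp⟩
  simp [Finset.sum_add_distrib, ← Finset.mul_sum, hu, hv, hw]

theorem span_sub (n : ℕ) [NeZero n] (c : ℝ) {x} (hx : x ∈ affineSpan ℝ (S n c)) : x ∈ A n c := by
  let B : AffineSubspace ℝ (Matrix (ZMod n) (ZMod n) ℝ) :=
    { carrier := A n c
      smul_vsub_vadd_mem' := fun t _ _ _ h1 h2 h3 => A_comb n c h1 h2 h3 t }
  have : affineSpan ℝ (S n c) ≤ B := affineSpan_le_of_subset_coe (S_sub_A n c)
  exact this hx

theorem center_mem (n : ℕ) [NeZero n] (c : ℝ) (hc : 0 < c) :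
    (Matrix.of fun _ _ => c / n : Matrix (ZMod n) (ZMod n) ℝ) ∈ S n c := by
  have hn : (n : ℝ) ≠ 0 := NeZero.ne _
  refine ⟨fun _ => c / (2 * n), fun _ => by positivity, ?_, ?_⟩
  · simp [ZMod.card]; field_simp
  · ext b j
    simp [LL_apply]; field_simp; ring

theorem interior_iff (n : ℕ) [NeZero n] (c : ℝ) (hc : 0 < c) (x : Matrix (ZMod n) (ZMod n) ℝ) :
    x ∈ intrinsicInterior ℝ (S n c) ↔ x ∈ S n c ∧ ∀ b j, 0 < x b j := by
  rw [mem_intrinsicInterior]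
  constructor
  · rintro ⟨y, hy, rfl⟩
    have hyS : (y : Matrix (ZMod n) (ZMod n) ℝ) ∈ S n c := by
      have h := interior_subset hy
      exact h
    refine ⟨hyS, fun b j => ?_⟩
    refine lt_of_le_of_ne (S_nonneg n c hyS b j) fun h0 => ?_
    have hn : (0 : ℝ) < n := Nat.cast_pos.2 (NeZero.pos n)
    let p : affineSpan ℝ (S n c) := ⟨_, subset_affineSpan ℝ _ (center_mem n c hc)⟩
    let f : ℝ → affineSpan ℝ (S n c) := fun t =>
      ⟨t • ((y : Matrix (ZMod n) (ZMod n) ℝ) - p) + y,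
        (affineSpan ℝ (S n c)).smul_vsub_vadd_mem t y.2 p.2 y.2⟩
    have hf : Continuous f := by
      refine Continuous.subtype_mk ?_ _
      fun_prop
    have hf0 : f 0 = y := Subtype.ext (by simp [f])
    have hev : ∀ᶠ t in nhds (0 : ℝ), f t ∈ interior ((↑) ⁻¹' S n c : Set (affineSpan ℝ (S n c))) := by
      apply hf.continuousAt.eventually_mem
      rw [hf0]
      exact isOpen_interior.mem_nhds hy
    have hev2 := (hev.filter_mono (nhdsWithin_le_nhds (s := Set.Ioi 0))).and self_mem_nhdsWithin
    obtain ⟨t, ht, htpos⟩ := hev2.exists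
    have h1 : (f t : Matrix (ZMod n) (ZMod n) ℝ) ∈ S n c := by
      have h := interior_subset ht
      exact h
    have h2 := S_nonneg n c h1 b j
    simp only [f, p, Matrix.add_apply, Matrix.smul_apply, Matrix.sub_apply, Matrix.of_apply,
      smul_eq_mul, ← h0] at h2
    have : 0 < t * (c / n) := mul_pos htpos (by positivity)
    linarith
  · rintro ⟨hx, hpos⟩
    refine ⟨⟨x, subset_affineSpan ℝ _ hx⟩, ?_, rfl⟩
    rw [mem_interior]
    refine ⟨{y | ∀ b j, 0 < (y : Matrix (ZMod n) (ZMod n) ℝ) b j}, ?_, ?_, hpos⟩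
    · intro y hy
      exact mem_S n c (span_sub n c y.2) fun b j => (hy b j).le
    · simp only [Set.ofPred_forall]
      refine isOpen_iInter_of_finite fun b => isOpen_iInter_of_finite fun j => ?_
      refine isOpen_lt continuous_const ?_
      exact (continuous_subtype_val).matrix_elem b j

theorem row_sum (n : ℕ) [NeZero n] (c : ℝ) {x} (hx : x ∈ A n c) (b : ZMod n) :
    ∑ j, x b j = c := by
  obtain ⟨u, hu, rfl⟩ := hx
  simp only [LL_apply, Finset.sum_add_distrib]
  rw [← hu, Fintype.sum_prod_type, Fintype.sum_bool, add_comm]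
  congr 1
  exact Equiv.sum_comp (Equiv.subRight b) (fun k => u (true, k))

/-- Pushing from `x` through an averaged point of an extreme convex set `F`. -/
theorem push (n : ℕ) [NeZero n] (P F : Set (Matrix (ZMod n) (ZMod n) ℝ))
    (hF : IsExtreme ℝ P F) (hc : Convex ℝ F) (hne : F.Nonempty) (C : Set (ZMod n × ZMod n))
    (hge : ∀ f ∈ F, ∀ b j, 0 ≤ f b j + 1)
    (hC : ∀ p ∈ C, ∃ f ∈ F, 0 < f p.1 p.2 + 1) (x) (hx : x ∈ P) :
    ∃ w ∈ F, ∃ ε : ℝ, (∀ p ∈ C, 0 ≤ (ε • (w - x) + w) p.1 p.2 + 1) ∧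
      (ε • (w - x) + w ∈ P → x ∈ F) := by
  classical
  obtain ⟨f0, hf0⟩ := hne
  have hz : ∀ p : ZMod n × ZMod n, ∃ f ∈ F, p ∈ C → 0 < f p.1 p.2 + 1 := by
    intro p
    by_cases hp : p ∈ C
    · obtain ⟨f, h1, h2⟩ := hC p hp
      exact ⟨f, h1, fun _ => h2⟩
    · exact ⟨f0, hf0, fun h => absurd h hp⟩
  choose z hz1 hz2 using hz
  let N : ℝ := Fintype.card (ZMod n × ZMod n)
  have hN : 0 < N := Nat.cast_pos.2 Fintype.card_pos
  have hsum1 : ∑ _p : ZMod n × ZMod n, N⁻¹ = 1 := by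
    rw [Finset.sum_const, Finset.card_univ, nsmul_eq_mul]
    exact mul_inv_cancel₀ hN.ne'
  let w : Matrix (ZMod n) (ZMod n) ℝ := ∑ p, N⁻¹ • z p
  have hw : w ∈ F := hc.sum_mem (fun _ _ => (inv_pos.2 hN).le) hsum1 (fun p _ => hz1 p)
  have hwpos : ∀ p ∈ C, 0 < w p.1 p.2 + 1 := by
    intro p hp
    have : w p.1 p.2 + 1 = ∑ q, N⁻¹ * (z q p.1 p.2 + 1) := by
      simp only [w, Matrix.sum_apply, Matrix.smul_apply, smul_eq_mul, mul_add, mul_one,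
        Finset.sum_add_distrib, hsum1]
    rw [this]
    refine Finset.sum_pos' (fun q _ => mul_nonneg (inv_pos.2 hN).le (hge _ (hz1 q) _ _))
      ⟨p, Finset.mem_univ _, mul_pos (inv_pos.2 hN) (hz2 p hp)⟩
  have hev : ∀ᶠ ε in nhds (0 : ℝ), ∀ p : ZMod n × ZMod n, p ∈ C →
      0 < ε * (w p.1 p.2 - x p.1 p.2) + w p.1 p.2 + 1 := by
    rw [Filter.eventually_all]
    intro p
    by_cases hp : p ∈ C
    · have hcont : Continuous fun ε : ℝ => ε * (w p.1 p.2 - x p.1 p.2) + w p.1 p.2 + 1 := by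
        fun_prop
      have := hcont.continuousAt.eventually_mem (x := 0)
        (s := Set.Ioi 0) (Ioi_mem_nhds (by simpa using hwpos p hp))
      filter_upwards [this] with ε h _ using h
    · exact Filter.Eventually.of_forall fun _ h => absurd h hp
  have hev2 := (hev.filter_mono (nhdsWithin_le_nhds (s := Set.Ioi 0))).and self_mem_nhdsWithin
  obtain ⟨ε, hε, hεpos⟩ := hev2.exists
  have hεpos : 0 < ε := hεpos
  refine ⟨w, hw, ε, fun p hp => ?_, fun hP => ?_⟩
  · simpa using (hε p hp).le
  · refine hF.left_mem_of_mem_openSegment hx hP hw ?_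
    refine ⟨ε / (1 + ε), 1 / (1 + ε), by positivity, by positivity, by field_simp; ring, ?_⟩
    ext b j
    simp
    field_simp
    ring

theorem dim_lower (n : ℕ) [NeZero n] (P : Set (Matrix (ZMod n) (ZMod n) ℝ))
    (hP : ∀ x, x ∈ P ↔ x + (Matrix.of fun _ _ => (1 : ℝ)) ∈ S n n) :
    2 * n - 2 ≤ Module.finrank ℝ (vectorSpan ℝ P) := by
  classical
  have hn : 0 < n := NeZero.pos n
  have hnR : (0 : ℝ) < n := Nat.cast_pos.2 hn
  let e : {i : Bool × ZMod n // i ≠ (true, 0)} → Matrix (ZMod n) (ZMod n) ℝ := fun i =>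
    LL n (Pi.single i.1 (n : ℝ)) - Matrix.of fun _ _ => (1 : ℝ)
  have hmem : Set.range e ⊆ P := by
    rintro _ ⟨i, rfl⟩
    rw [hP]
    refine ⟨Pi.single i.1 (n : ℝ), fun j => ?_, by simp, by simp [e]⟩
    rw [Pi.single_apply]; split_ifs <;> positivity
  have hind : AffineIndependent ℝ e := by
    rw [affineIndependent_iff]
    intro s w hw hsum
    have h1 : LL n (∑ i ∈ s, w i • Pi.single i.1 (n : ℝ)) = 0 := by
      simp only [map_sum, map_smul]
      rw [← hsum]
      simp only [e, smul_sub, Finset.sum_sub_distrib, ← Finset.sum_smul, hw, zero_smul, sub_zero]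
    set u : Bool × ZMod n → ℝ := ∑ i ∈ s, w i • Pi.single i.1 (n : ℝ) with hu
    have hval : ∀ k, u k = ∑ i ∈ s, if i.1 = k then w i * n else 0 := by
      intro k
      simp only [hu, Finset.sum_apply, Pi.smul_apply, Pi.single_apply, smul_eq_mul, mul_ite,
        mul_zero, eq_comm]
    have hu0 : u (true, 0) = 0 := by
      rw [hval]
      refine Finset.sum_eq_zero fun i _ => if_neg i.2
    have hL : ∀ j k, u (false, j) + u (true, k) = 0 := by
      intro j k
      have := congrFun (congrFun h1 (j - k)) j
      rwa [LL_apply, sub_sub_cancel] at this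
    have huz : ∀ k, u k = 0 := by
      have hf : ∀ j, u (false, j) = 0 := fun j => by linarith [hL j 0]
      rintro ⟨c, k⟩
      cases c
      · exact hf k
      · linarith [hL 0 k, hf 0]
    intro i hi
    have := huz i.1
    rw [hval, Finset.sum_eq_single i] at this
    · simpa [hnR.ne'] using this
    · intro k _ hk
      exact if_neg fun h => hk (Subtype.ext h)
    · exact fun h => absurd hi h
  have hcard : Fintype.card {i : Bool × ZMod n // i ≠ (true, 0)} = (2 * n - 2) + 1 := by
    rw [Fintype.card_subtype_compl, Fintype.card_prod, ZMod.card]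
    simp; omega
  rw [← hind.finrank_vectorSpan hcard]
  exact Submodule.finrank_mono (vectorSpan_mono ℝ hmem)

theorem dim_upper (n : ℕ) [NeZero n] (hn : 3 ≤ n) (F : Set (Matrix (ZMod n) (ZMod n) ℝ))
    (a b t : Bool × ZMod n) (hab : a ≠ b) (hat : a ≠ t) (hbt : b ≠ t)
    (hF : ∀ x ∈ F, ∃ u : Bool × ZMod n → ℝ, u a = 0 ∧ u b = 0 ∧ u t = 0 ∧ ∑ i, u i = n ∧
      LL n u = x + Matrix.of fun _ _ => (1 : ℝ)) :
    Module.finrank ℝ (vectorSpan ℝ F) ≤ 2 * n - 4 := by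
  classical
  have hcard : Fintype.card (Bool × ZMod n) = 2 * n := by
    rw [Fintype.card_prod, ZMod.card]; simp
  have h3 : ({a, b, t} : Finset (Bool × ZMod n)).card = 3 := by
    rw [Finset.card_eq_three]; exact ⟨a, b, t, hab, hat, hbt, rfl⟩
  obtain ⟨s, hs⟩ : ∃ s, s ∉ ({a, b, t} : Finset (Bool × ZMod n)) := by
    by_contra! h
    have := Finset.eq_univ_of_forall h
    rw [this, Finset.card_univ, hcard] at h3
    omega
  let E : Finset (Bool × ZMod n) := insert s {a, b, t}
  have hE : E.card = 4 := by rw [Finset.card_insert_of_notMem hs, h3]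
  let W : Submodule ℝ (Bool × ZMod n → ℝ) :=
    { carrier := {u | u a = 0 ∧ u b = 0 ∧ u t = 0 ∧ ∑ i, u i = 0}
      add_mem' := by
        rintro u v ⟨h1, h2, h3, h4⟩ ⟨k1, k2, k3, k4⟩
        simp [h1, h2, h3, k1, k2, k3, Finset.sum_add_distrib, h4, k4]
      zero_mem' := by simp
      smul_mem' := by
        rintro c u ⟨h1, h2, h3, h4⟩
        simp [h1, h2, h3, ← Finset.mul_sum, h4] }
  have hle : vectorSpan ℝ F ≤ W.map (LL n) := by
    rw [vectorSpan_def, Submodule.span_le]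
    rintro _ ⟨x, hx, y, hy, rfl⟩
    obtain ⟨u, h1, h2, h3, h4, h5⟩ := hF x hx
    obtain ⟨v, k1, k2, k3, k4, k5⟩ := hF y hy
    refine ⟨u - v, ⟨?_, ?_, ?_, ?_⟩, ?_⟩
    · simp [h1, k1]
    · simp [h2, k2]
    · simp [h3, k3]
    · simp [h4, k4]
    · simp [h5, k5]
  have hW : Module.finrank ℝ W ≤ 2 * n - 4 := by
    let r : W →ₗ[ℝ] ({i // i ∉ E} → ℝ) :=
      { toFun := fun u i => u.1 i.1
        map_add' := fun _ _ => rfl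
        map_smul' := fun _ _ => rfl }
    have hr : Function.Injective r := by
      rw [← LinearMap.ker_eq_bot, LinearMap.ker_eq_bot']
      rintro ⟨u, h1, h2, h3, h4⟩ hu
      have hz : ∀ i, i ≠ s → u i = 0 := by
        intro i hi
        by_cases hiE : i ∈ E
        · simp only [E, Finset.mem_insert, Finset.mem_singleton] at hiE
          rcases hiE with rfl | rfl | rfl | rfl
          · exact absurd rfl hi
          all_goals assumption
        · exact congrFun hu ⟨i, hiE⟩
      have hs0 : u s = 0 := by
        rw [← h4, Finset.sum_eq_single s]
        · exact fun i _ hi => hz i hi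
        · simp
      ext i
      by_cases hi : i = s
      · subst hi; exact hs0
      · exact hz i hi
    have := LinearMap.finrank_le_finrank_of_injective hr
    rw [Module.finrank_fintype_fun_eq_card, Fintype.card_subtype_compl, hcard] at this
    simpa [hE] using this
  calc _ ≤ _ := Submodule.finrank_mono hle
    _ ≤ _ := Submodule.finrank_map_le _ _
    _ ≤ _ := hW

theorem facet_main (n : ℕ) [NeZero n] (hn : 3 ≤ n) (P F : Set (Matrix (ZMod n) (ZMod n) ℝ))
    (hP : ∀ x, x ∈ P ↔ x + (Matrix.of fun _ _ => (1 : ℝ)) ∈ S n n)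
    (hF : IsExtreme ℝ P F) (hc : Convex ℝ F)
    (hd : Module.finrank ℝ (vectorSpan ℝ F) = 2 * n - 3) :
    ∃ b0 j0, F = {x ∈ P | x b0 j0 = -1} := by
  have hne : F.Nonempty := by
    by_contra h
    rw [Set.not_nonempty_iff_eq_empty] at h
    subst h
    rw [vectorSpan_empty, finrank_bot] at hd
    omega
  have hgeP : ∀ f ∈ P, ∀ b j, 0 ≤ f b j + 1 := fun f hf b j =>
    S_nonneg n n ((hP f).1 hf) b j
  have hge : ∀ f ∈ F, ∀ b j, 0 ≤ f b j + 1 := fun f hf => hgeP f (hF.subset hf)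
  have hA : ∀ w ∈ F, ∀ x ∈ P, ∀ ε : ℝ,
      ε • (w - x) + w + (Matrix.of fun _ _ => (1 : ℝ)) ∈ A n n := by
    intro w hw x hx ε
    have h1 := S_sub_A n n ((hP w).1 (hF.subset hw))
    have h2 := S_sub_A n n ((hP x).1 hx)
    have h3 := A_comb n n h1 h2 h1 ε
    rwa [add_sub_add_right_eq_sub, ← add_assoc] at h3
  obtain ⟨b0, j0, h0⟩ : ∃ b0 j0, ∀ f ∈ F, f b0 j0 + 1 = 0 := by
    by_contra! hcon
    have hPF : P ⊆ F := by
      intro x hx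
      obtain ⟨w, hw, ε, h1, h2⟩ := push n P F hF hc hne Set.univ hge
        (fun p _ => by
          obtain ⟨f, hf, h⟩ := hcon p.1 p.2
          exact ⟨f, hf, lt_of_le_of_ne (hge f hf _ _) h.symm⟩) x hx
      refine h2 ((hP _).2 (mem_S n n (hA w hw x hx ε) fun b j => ?_))
      exact h1 (b, j) trivial
    have := dim_lower n P hP
    rw [Set.Subset.antisymm hPF hF.subset] at this
    omega
  refine ⟨b0, j0, Set.Subset.antisymm (fun f hf => ⟨hF.subset hf, by linarith [h0 f hf]⟩) ?_⟩
  rintro x ⟨hx, hx0⟩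
  obtain ⟨w, hw, ε, h1, h2⟩ := push n P F hF hc hne
    {p | (p.2 = j0 ∨ p.2 - p.1 = j0 - b0) ∧ p ≠ (b0, j0)} hge
    (by
      rintro ⟨b, j⟩ ⟨hbj, hneq⟩
      by_contra! hcon
      have hz : ∀ f ∈ F, f b j + 1 = 0 := fun f hf => le_antisymm (hcon f hf) (hge f hf b j)
      have hex : ∃ t : Bool × ZMod n, (false, j0) ≠ t ∧ (true, j0 - b0) ≠ t ∧
          (t = (false, j) ∨ t = (true, j - b)) := by
        rcases hbj with h | h
        · simp only at h
          refine ⟨(true, j - b), by simp, ?_, Or.inr rfl⟩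
          intro h'
          apply hneq
          simp only [Prod.mk.injEq, true_and] at h'
          subst h
          simp only [Prod.mk.injEq, and_true]
          exact (sub_right_injective h').symm
        · simp only at h
          refine ⟨(false, j), ?_, by simp, Or.inl rfl⟩
          intro h'
          apply hneq
          simp only [Prod.mk.injEq, true_and] at h'
          subst h'
          simp only [Prod.mk.injEq, and_true]
          exact sub_right_injective h
      obtain ⟨t, ht1, ht2, ht3⟩ := hex
      have := dim_upper n hn F (false, j0) (true, j0 - b0) t (by simp) ht1 ht2 (by
        intro f hf
        obtain ⟨u, hu0, hu1, hu2⟩ := (hP f).1 (hF.subset hf)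
        have e1 : u (false, j0) + u (true, j0 - b0) = 0 := by
          rw [← LL_apply, hu2]; exact h0 f hf
        have e2 : u (false, j) + u (true, j - b) = 0 := by
          rw [← LL_apply, hu2]; exact hz f hf
        refine ⟨u, ?_, ?_, ?_, hu1, hu2⟩
        · linarith [hu0 (false, j0), hu0 (true, j0 - b0)]
        · linarith [hu0 (false, j0), hu0 (true, j0 - b0)]
        · rcases ht3 with rfl | rfl <;> linarith [hu0 (false, j), hu0 (true, j - b)])
      omega) x hx
  have hy0 : (ε • (w - x) + w) b0 j0 + 1 = 0 := by
    have := h0 w hw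
    have hw0 : w b0 j0 = -1 := by linarith
    simp [hw0, hx0]
  refine h2 ((hP _).2 (mem_facet n n (hA w hw x hx ε) b0 j0 hy0 fun b j hbj => ?_))
  by_cases h : (b, j) = (b0, j0)
  · simp only [Prod.mk.injEq] at h
    obtain ⟨rfl, rfl⟩ := h
    exact hy0.ge
  · exact h1 (b, j) ⟨hbj, h⟩

end QGor

/-- `(1/n,...,1/n)` is in the relative interior of `Q_n`; the all-ones
vector `m` is the unique interior lattice point of `n·Q_n`; and `n·Q_n - m` is reflexive
(every facet lies on a hyperplane `a·x = 1` with integral `a`, and the polytope lies on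
the side `a·x ≤ 1`).  Hence `Q_n` is a Gorenstein polytope of codegree `n`. -/
theorem Q_Gorenstein_codegree_n (n : ℕ) [NeZero n] (hn : 3 ≤ n) :
    (Matrix.of fun _ _ => (n : ℝ)⁻¹ : Matrix (ZMod n) (ZMod n) ℝ) ∈
      intrinsicInterior ℝ (Qpoly n) ∧
    {x | x ∈ intrinsicInterior ℝ ((n : ℝ) • Qpoly n) ∧ IsInt n x}
      = {(Matrix.of fun _ _ => (1 : ℝ) : Matrix (ZMod n) (ZMod n) ℝ)} ∧
    (∀ F : Set (Matrix (ZMod n) (ZMod n) ℝ),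
      IsExtreme ℝ ((fun x => x - Matrix.of fun _ _ => (1 : ℝ)) '' ((n : ℝ) • Qpoly n)) F →
      Convex ℝ F → Module.finrank ℝ (vectorSpan ℝ F) = 2 * n - 3 →
      ∃ a : ZMod n → ZMod n → ℤ,
        (∀ x ∈ (fun x => x - Matrix.of fun _ _ => (1 : ℝ)) '' ((n : ℝ) • Qpoly n),
          ∑ b, ∑ j, (a b j : ℝ) * x b j ≤ 1) ∧
        F = {x ∈ (fun x => x - Matrix.of fun _ _ => (1 : ℝ)) '' ((n : ℝ) • Qpoly n) |
          ∑ b, ∑ j, (a b j : ℝ) * x b j = 1}) := by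
  classical
  have hnR : (0 : ℝ) < n := Nat.cast_pos.2 (NeZero.pos n)
  refine ⟨?_, ?_, ?_⟩
  · rw [QGor.Q_eq, QGor.interior_iff n 1 one_pos]
    refine ⟨?_, fun _ _ => inv_pos.2 hnR⟩
    have := QGor.center_mem n 1 one_pos
    rwa [one_div] at this
  · rw [QGor.smulQ_eq n n hnR]
    ext x
    simp only [Set.mem_ofPred_eq, Set.mem_singleton_iff, QGor.interior_iff n n hnR]
    constructor
    · rintro ⟨⟨hx, hpos⟩, hint⟩
      have hge : ∀ b j, 1 ≤ x b j := by
        intro b j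
        obtain ⟨z, hz⟩ := hint b j
        have := hpos b j
        rw [hz] at this ⊢
        exact_mod_cast this
      ext b j
      have hs := QGor.row_sum n n (QGor.S_sub_A n n hx) b
      have h1 : ∑ _j : ZMod n, (1 : ℝ) = ∑ j, x b j := by
        rw [hs]; simp [ZMod.card]
      exact ((Finset.sum_eq_sum_iff_of_le fun j _ => hge b j).1 h1 j (Finset.mem_univ _)).symm
    · rintro rfl
      have := QGor.center_mem n n hnR
      rw [div_self hnR.ne'] at this
      exact ⟨⟨this, fun _ _ => one_pos⟩, fun _ _ => ⟨1, by simp⟩⟩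
  · rw [QGor.smulQ_eq n n hnR]
    intro F hF hc hd
    set P := (fun x => x - Matrix.of fun _ _ => (1 : ℝ)) '' (QGor.S n n) with hPdef
    have hP : ∀ x, x ∈ P ↔ x + (Matrix.of fun _ _ => (1 : ℝ)) ∈ QGor.S n n := by
      intro x
      constructor
      · rintro ⟨y, hy, rfl⟩
        simpa using hy
      · intro h
        exact ⟨_, h, by simp⟩
    obtain ⟨b0, j0, hFe⟩ := QGor.facet_main n hn P F hP hF hc hd
    have hsum : ∀ x : Matrix (ZMod n) (ZMod n) ℝ,
        ∑ b, ∑ j, (((if b = b0 ∧ j = j0 then (-1 : ℤ) else 0) : ℤ) : ℝ) * x b j = - x b0 j0 := by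
      intro x
      rw [Finset.sum_eq_single b0, Finset.sum_eq_single j0]
      · simp
      · intro j _ hj; simp [hj]
      · simp
      · intro b _ hb; simp [hb]
      · simp
    refine ⟨fun b j => if b = b0 ∧ j = j0 then -1 else 0, ?_, ?_⟩
    · intro x hx
      rw [hsum]
      have : 0 ≤ x b0 j0 + 1 := QGor.S_nonneg n n ((hP x).1 hx) b0 j0
      linarith
    · rw [hFe]
      ext x
      simp only [Set.mem_ofPred_eq, hsum]
      constructor <;> rintro ⟨h1, h2⟩ <;> exact ⟨h1, by linarith⟩
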